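/- Assume Condition (D) and consider the coupling construction. Then for all (x, x') ∈ X²: E_{x,x',0}[ Σ_{n=0}^{τ−1} r(n) ] ≤ (1/(ε_b φ(1))) · [ (1 + c_* b̄ r(1)²/(ε_b φ(1))) · V̄(x, x') + ( c_* b̄ r(1) − 1 − c_* b̄ r(1)²/(ε_b φ(1)) ) ], where V̄(x, x') = V(x) + V(x') − 1 and b̄, c_* are the explicit constants defined in the context. -/

import Mathlib

open MeasureTheory ProbabilityTheory Filter Set

noncomputable def iterKernel {X : Type*} [MeasurableSpace X]
    (P : ℕ → Kernel X X) : ℕ → Kernel X X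
  | 0 => Kernel.id
  | n + 1 => (P (n + 1)).comp (iterKernel P n)

noncomputable def Hfun (φ : ℝ → ℝ) (t : ℝ) : ℝ := ∫ s in (1:ℝ)..t, (φ s)⁻¹

noncomputable def Hinv (φ : ℝ → ℝ) : ℝ → ℝ := Function.invFunOn (Hfun φ) (Set.Ici 1)

noncomputable def rate (φ : ℝ → ℝ) (εb : ℝ) (n : ℕ) : ℝ := φ (Hinv φ (εb * n)) / φ 1

noncomputable def deltaSeq (φ : ℝ → ℝ) (εb : ℝ) (k : ℕ) : ℝ := εb * deriv φ (Hinv φ (εb * k))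

noncomputable def bbar (φ : ℝ → ℝ) (εb bV : ℝ) : ℝ := 2 * bV + εb * φ 1

noncomputable def Mone (φ : ℝ → ℝ) (εb εν bV cV : ℝ) : ℝ :=
  rate φ εb 1 * (1 + 2 * rate φ εb 1 / (εb * φ 1) * ((bV + cV) / (1 - εν) - 1))

noncomputable def cstar (φ : ℝ → ℝ) (εb εν bV cV : ℝ) : ℝ :=
  ∑' j : ℕ, (1 - εν) ^ j * ∏ k ∈ Finset.Icc 1 j, (1 + deltaSeq φ εb k * Mone φ εb εν bV cV)

noncomputable def cconst (φ : ℝ → ℝ) (εb εν bV cV : ℝ) : ℝ :=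
  2 / (εb * φ 1) * (2 + bbar φ εb bV / εν +
    cstar φ εb εν bV cV * bbar φ εb bV * rate φ εb 1 * (1 + rate φ εb 1 / (εb * φ 1)))

noncomputable def Qmeas {X : Type*} [MeasurableSpace X]
    (P : ℕ → Kernel X X) (ν : ℕ → Measure X) (εν : ℝ) (k : ℕ) (x : X) : Measure X :=
  (ENNReal.ofReal (1 - εν))⁻¹ • (P k x - ENNReal.ofReal εν • ν k)

lemma le_tangent_of_antitoneOn {f f' : ℝ → ℝ} (hf : ContinuousOn f (Ici 1))
    (hd : ∀ x, 1 < x → HasDerivAt f (f' x) x) (ha : AntitoneOn f' (Ici 1))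
    {u v : ℝ} (hu : 1 ≤ u) (hv : 1 ≤ v) : f u ≤ f v + f' v * (u - v) := by
  rcases lt_trichotomy u v with h | rfl | h
  · obtain ⟨c, hc, hc'⟩ := exists_hasDerivAt_eq_slope f f' h
      (hf.mono fun x hx => le_trans hu hx.1) (fun x hx => hd x (lt_of_le_of_lt hu hx.1))
    have h1 := ha (show c ∈ Ici 1 from le_trans hu hc.1.le) (show v ∈ Ici 1 from hv) hc.2.le
    rw [hc', le_div_iff₀ (by linarith)] at h1
    linarith
  · simp
  · obtain ⟨c, hc, hc'⟩ := exists_hasDerivAt_eq_slope f f' h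
      (hf.mono fun x hx => le_trans hv hx.1) (fun x hx => hd x (lt_of_le_of_lt hv hx.1))
    have h1 := ha (show v ∈ Ici 1 from hv) (show c ∈ Ici 1 from le_trans hv hc.1.le) hc.1.le
    rw [hc', div_le_iff₀ (by linarith)] at h1
    linarith

lemma ConcaveOn.le_tangent {φ : ℝ → ℝ} (hφ : ConcaveOn ℝ (Ici 1) φ)
    (hd : ∀ t, 1 ≤ t → DifferentiableAt ℝ φ t) {u v : ℝ} (hu : 1 ≤ u) (hv : 1 ≤ v) :
    φ u ≤ φ v + deriv φ v * (u - v) :=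
  le_tangent_of_antitoneOn (fun x hx => (hd x hx).continuousAt.continuousWithinAt)
    (fun x hx => (hd x hx.le).hasDerivAt) (hφ.antitoneOn_deriv hd) hu hv

lemma ConcaveOn.add_le_add_of_Ici_one {φ : ℝ → ℝ} (hφ : ConcaveOn ℝ (Ici 1) φ) {a b : ℝ}
    (ha : 1 ≤ a) (hb : 1 ≤ b) : φ (a + b - 1) + φ 1 ≤ φ a + φ b := by
  rcases eq_or_lt_of_le ha with rfl | ha'
  · simp [add_comm]
  have hT : 0 < a + b - 2 := by linarith
  have h1 : (1:ℝ) ∈ Ici (1:ℝ) := self_mem_Ici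
  have h2 : a + b - 1 ∈ Ici (1:ℝ) := by simp only [mem_Ici]; linarith
  have hs : (b - 1) / (a + b - 2) + (a - 1) / (a + b - 2) = 1 := by field_simp; ring
  have p1 : 0 ≤ (b - 1) / (a + b - 2) := div_nonneg (by linarith) hT.le
  have p2 : 0 ≤ (a - 1) / (a + b - 2) := div_nonneg (by linarith) hT.le
  have e1 := hφ.2 h1 h2 p1 p2 hs
  have e2 := hφ.2 h1 h2 p2 p1 (by linarith)
  simp only [smul_eq_mul] at e1 e2
  have k1 : (b - 1) / (a + b - 2) * 1 + (a - 1) / (a + b - 2) * (a + b - 1) = a := by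
    field_simp; ring
  have k2 : (a - 1) / (a + b - 2) * 1 + (b - 1) / (a + b - 2) * (a + b - 1) = b := by
    field_simp; ring
  rw [k1] at e1
  rw [k2] at e2
  have h3 : (b - 1) / (a + b - 2) = 1 - (a - 1) / (a + b - 2) := by linarith
  rw [h3] at e1 e2
  linarith

/-- The inverse of `Hfun φ` extends to a strictly increasing function `g` with derivative `φ ∘ g`. -/
lemma exists_flow {φ : ℝ → ℝ} (hφconc : ConcaveOn ℝ (Ici 1) φ)
    (hφdiff : ∀ t, 1 ≤ t → DifferentiableAt ℝ φ t) (hφpos : ∀ t, 1 ≤ t → 0 < φ t)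
    (hφmono : MonotoneOn φ (Ici 1)) :
    ∃ h g : ℝ → ℝ, StrictMono g ∧ Continuous h ∧ (∀ t, h (g t) = t) ∧ (∀ v, g (h v) = v) ∧
      g 0 = 1 ∧ (∀ t, 0 ≤ t → HasDerivAt g (φ (g t)) t) ∧
      (∀ v, 1 < v → HasDerivAt h (φ v)⁻¹ v) ∧ ∀ t, 0 ≤ t → Hinv φ t = g t := by
  set ψ : ℝ → ℝ := fun t => φ (max t 1) with hψ
  have hψc : Continuous ψ := by
    have hc : ContinuousOn φ (Ici 1) := fun x hx => (hφdiff x hx).continuousAt.continuousWithinAt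
    exact hc.comp_continuous (by fun_prop) (fun x => le_max_right x 1)
  have hψpos : ∀ t, 0 < ψ t := fun t => hφpos _ (le_max_right t 1)
  have hψe : ∀ t, 1 ≤ t → ψ t = φ t := fun t ht => by simp [hψ, max_eq_left ht]
  have hic : Continuous fun s => (ψ s)⁻¹ := hψc.inv₀ fun t => (hψpos t).ne'
  set h : ℝ → ℝ := fun t => ∫ s in (1:ℝ)..t, (ψ s)⁻¹ with hh
  have hd : ∀ t, HasDerivAt h (ψ t)⁻¹ t := fun t =>
    (hic.integral_hasStrictDerivAt 1 t).hasDerivAt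
  have hcont : Continuous h := continuous_iff_continuousAt.2 fun t => (hd t).continuousAt
  have hmono : StrictMono h := strictMono_of_hasDerivAt_pos hd fun t => inv_pos.2 (hψpos t)
  have h1 : h 1 = 0 := by simp [hh]
  have hbot : Tendsto h atBot atBot := by
    have : ∀ t ≤ (1:ℝ), h t ≤ (φ 1)⁻¹ * (t - 1) := by
      intro t ht
      have e : h t = ∫ s in (1:ℝ)..t, (φ 1)⁻¹ := by
        refine intervalIntegral.integral_congr fun s hs => ?_
        rw [uIcc_of_ge ht] at hs
        simp [hψ, max_eq_right hs.2]
      rw [e]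
      simp [mul_comm]
    refine tendsto_atBot_mono' _ ((eventually_le_atBot 1).mono this) ?_
    exact (tendsto_atBot_add_const_right _ (-1) tendsto_id).const_mul_atBot
      (inv_pos.2 (hφpos 1 le_rfl))
  have hd1 : 0 ≤ deriv φ 1 := by
    have := hφconc.le_tangent hφdiff (show (1:ℝ) ≤ 2 by norm_num) le_rfl
    have h2 := hφmono self_mem_Ici (show (2:ℝ) ∈ Ici 1 by norm_num) (by norm_num)
    linarith
  have htop : Tendsto h atTop atTop := by
    set K := φ 1 + deriv φ 1 with hK
    have hKpos : 0 < K := by have := hφpos 1 le_rfl; linarith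
    have hlin : ∀ t, 1 ≤ t → φ t ≤ K * t := by
      intro t ht
      have := hφconc.le_tangent hφdiff ht le_rfl
      have h3 := hφpos 1 le_rfl
      nlinarith
    have hlog : ∀ t, 1 ≤ t → K⁻¹ * Real.log t ≤ h t := by
      intro t ht
      have hm : MonotoneOn (fun t => h t - K⁻¹ * Real.log t) (Ici 1) := by
        have hder : ∀ x, 1 ≤ x → HasDerivAt (fun t => h t - K⁻¹ * Real.log t)
            ((ψ x)⁻¹ - K⁻¹ * x⁻¹) x := fun x hx =>
          (hd x).sub ((Real.hasDerivAt_log (by linarith)).const_mul _)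
        refine monotoneOn_of_deriv_nonneg (convex_Ici 1)
          (fun x hx => (hder x hx).continuousAt.continuousWithinAt) (fun x hx => ?_)
          (fun x hx => ?_)
        · rw [interior_Ici] at hx
          exact (hder x hx.le).differentiableAt.differentiableWithinAt
        · rw [interior_Ici] at hx
          have hx' : 1 ≤ x := le_of_lt hx
          rw [(hder x hx').deriv, sub_nonneg, ← mul_inv, hψe x hx']
          exact inv_anti₀ (hφpos x hx') (hlin x hx')
      have := hm self_mem_Ici ht ht
      simp only [h1, Real.log_one] at this
      linarith
    exact tendsto_atTop_mono' _ ((eventually_ge_atTop 1).mono hlog)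
      (Real.tendsto_log_atTop.const_mul_atTop (inv_pos.2 hKpos))
  have hsurj := hcont.surjective htop hbot
  let e := hmono.orderIsoOfSurjective h hsurj
  have hge : ∀ v, e.symm (h v) = v := fun v => e.symm_apply_apply v
  have heg : ∀ t, h (e.symm t) = t := fun t => e.apply_symm_apply t
  have g0 : e.symm 0 = 1 := by rw [← h1, hge]
  have hg1 : ∀ t, 0 ≤ t → 1 ≤ e.symm t := fun t ht => g0 ▸ e.symm.monotone ht
  refine ⟨h, e.symm, e.symm.strictMono, hcont, heg, hge, g0, ?_, ?_, ?_⟩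
  · intro t ht
    have := HasDerivAt.of_local_left_inverse e.symm.continuous.continuousAt (hd (e.symm t))
      (inv_pos.2 (hψpos _)).ne' (Eventually.of_forall heg)
    rwa [inv_inv, hψe _ (hg1 t ht)] at this
  · intro v hv
    rw [← hψe v hv.le]
    exact hd v
  · intro t ht
    have hH : ∀ v, 1 ≤ v → Hfun φ v = h v := by
      intro v hv
      refine intervalIntegral.integral_congr fun s hs => ?_
      rw [uIcc_of_le hv] at hs
      simp [hψ, max_eq_left hs.1]
    have hex : ∃ a ∈ Ici (1:ℝ), Hfun φ a = t := ⟨e.symm t, hg1 t ht, by rw [hH _ (hg1 t ht), heg]⟩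
    have m1 : Hinv φ t ∈ Ici (1:ℝ) := Function.invFunOn_mem hex
    have m2 : Hfun φ (Hinv φ t) = t := Function.invFunOn_eq hex
    rw [hH _ m1] at m2
    rw [← hge (Hinv φ t), m2]

/-- The analytic facts about the potential `W n v = H⁻¹(H v + εb n) - H⁻¹(εb n)`;
`D n` is its derivative. -/
structure IsRatePotential (φ : ℝ → ℝ) (εb : ℝ) (W D : ℕ → ℝ → ℝ) : Prop where
  measurable : ∀ n, Measurable (W n)
  zero : ∀ v, W 0 v = v - 1
  one : ∀ n, W n 1 = 0
  nonneg : ∀ n v, 1 ≤ v → 0 ≤ W n v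
  tangent : ∀ n u v, 1 ≤ u → 1 ≤ v → W n u ≤ W n v + D n v * (u - v)
  deriv_nonneg : ∀ n v, 1 ≤ v → 0 ≤ D n v
  deriv_le : ∀ n v, 1 ≤ v → D n v ≤ rate φ εb n
  step : ∀ n v, 1 ≤ v →
    W (n + 1) v - εb * (φ v * D (n + 1) v) ≤ W n v - εb * φ 1 * rate φ εb n

lemma IsRatePotential.le_rate_mul {φ : ℝ → ℝ} {εb : ℝ} {W D : ℕ → ℝ → ℝ}
    (h : IsRatePotential φ εb W D) (n : ℕ) {u : ℝ} (hu : 1 ≤ u) :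
    W n u ≤ rate φ εb n * (u - 1) := by
  have h1 := h.tangent n u 1 hu le_rfl
  rw [h.one, zero_add] at h1
  exact h1.trans (mul_le_mul_of_nonneg_right (h.deriv_le n 1 le_rfl) (by linarith))

/-- The facts about the rate function and its increments. -/
structure IsRate (φ : ℝ → ℝ) (εb : ℝ) : Prop where
  one_le : ∀ n, 1 ≤ rate φ εb n
  succ_le : ∀ n, rate φ εb (n + 1) ≤ rate φ εb n * rate φ εb 1
  sub_le : ∀ n, rate φ εb (n + 1) - rate φ εb n ≤ deltaSeq φ εb n * rate φ εb (n + 1)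
  delta_nonneg : ∀ n, 0 ≤ deltaSeq φ εb n
  delta_anti : Antitone (deltaSeq φ εb)
  delta_tendsto : Tendsto (deltaSeq φ εb) atTop (nhds 0)

lemma exists_ratePotential {φ : ℝ → ℝ} {εb : ℝ} (hφconc : ConcaveOn ℝ (Ici 1) φ)
    (hφmono : MonotoneOn φ (Ici 1))
    (hφdiff : ∀ t, 1 ≤ t → DifferentiableAt ℝ φ t) (hφpos : ∀ t, 1 ≤ t → 0 < φ t)
    (hφderiv0 : Tendsto (deriv φ) atTop (nhds 0)) (hε : 0 < εb) :
    IsRate φ εb ∧ ∃ W D, IsRatePotential φ εb W D := by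
  obtain ⟨h, g, gmono, hcont, hg, gh, g0, gder, hder, hinv⟩ :=
    exists_flow hφconc hφdiff hφpos hφmono
  have g1 : ∀ t, 0 ≤ t → 1 ≤ g t := fun t ht => g0 ▸ gmono.monotone ht
  have h0 : h 1 = 0 := by rw [← g0, hg]
  have hmono : Monotone h := fun a b hab => by
    by_contra! hlt
    have := gmono hlt
    rw [gh, gh] at this
    linarith
  have hnn : ∀ v, 1 ≤ v → 0 ≤ h v := fun v hv => h0 ▸ hmono hv
  have φg : ∀ s t, 0 ≤ s → s ≤ t → φ (g s) ≤ φ (g t) := fun s t hs hst =>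
    hφmono (g1 s hs) (g1 t (hs.trans hst)) (gmono.monotone hst)
  have hdnn : ∀ t, 1 ≤ t → 0 ≤ deriv φ t := by
    intro t ht
    have := hφconc.le_tangent hφdiff (show (1:ℝ) ≤ t + 1 by linarith) ht
    have h2 := hφmono (show t ∈ Ici 1 from ht) (show t + 1 ∈ Ici (1:ℝ) by
      simp only [mem_Ici]; linarith) (by linarith)
    linarith
  have hanti := hφconc.antitoneOn_deriv hφdiff
  have gslope : ∀ s t, 0 ≤ s → s ≤ t →
      (t - s) * φ (g s) ≤ g t - g s ∧ g t - g s ≤ (t - s) * φ (g t) := by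
    intro s t hs hst
    rcases eq_or_lt_of_le hst with rfl | hlt
    · simp
    obtain ⟨c, hc, hc'⟩ := exists_hasDerivAt_eq_slope g (fun x => φ (g x)) hlt
      (fun x hx => (gder x (hs.trans hx.1)).continuousAt.continuousWithinAt)
      (fun x hx => gder x (hs.trans hx.1.le))
    have hpos : 0 < t - s := by linarith
    rw [eq_div_iff hpos.ne'] at hc'
    rw [← hc', mul_comm (φ (g c))]
    exact ⟨mul_le_mul_of_nonneg_left (φg s c hs hc.1.le) hpos.le,
      mul_le_mul_of_nonneg_left (φg c t (hs.trans hc.1.le) hc.2.le) hpos.le⟩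
  have ratio : ∀ s, 0 ≤ s → AntitoneOn (fun a => φ (g (a + s)) / φ (g a)) (Ici 0) := by
    intro s hs
    have hl : ∀ a, 0 ≤ a → HasDerivAt (fun a => Real.log (φ (g a))) (deriv φ (g a)) a := by
      intro a ha
      have h1 := ((hφdiff (g a) (g1 a ha)).hasDerivAt.comp a (gder a ha)).log
        (hφpos _ (g1 a ha)).ne'
      rw [mul_div_assoc, Function.comp_apply, div_self (hφpos _ (g1 a ha)).ne', mul_one] at h1
      exact h1
    have hq : ∀ a, 0 ≤ a → HasDerivAt (fun a => Real.log (φ (g (a + s))) - Real.log (φ (g a)))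
        (deriv φ (g (a + s)) - deriv φ (g a)) a := fun a ha =>
      ((hl (a + s) (by linarith)).comp_add_const a s).sub (hl a ha)
    have hlog : AntitoneOn (fun a => Real.log (φ (g (a + s))) - Real.log (φ (g a))) (Ici 0) := by
      refine antitoneOn_of_deriv_nonpos (convex_Ici 0)
        (fun x hx => (hq x hx).continuousAt.continuousWithinAt) (fun x hx => ?_) (fun x hx => ?_)
      · rw [interior_Ici] at hx
        exact (hq x (le_of_lt hx)).differentiableAt.differentiableWithinAt
      · rw [interior_Ici] at hx
        have hx' : 0 ≤ x := le_of_lt hx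
        rw [(hq x hx').deriv, sub_nonpos]
        exact hanti (g1 x hx') (g1 _ (by linarith)) (gmono.monotone (by linarith))
    intro a ha b hb hab
    have h1 := hlog ha hb hab
    have ha' : (0:ℝ) ≤ a := ha
    have hb' : (0:ℝ) ≤ b := hb
    have pa := hφpos _ (g1 a ha')
    have pb := hφpos _ (g1 b hb')
    have pas := hφpos _ (g1 (a + s) (by linarith))
    have pbs := hφpos _ (g1 (b + s) (by linarith))
    simp only at h1 ⊢
    rw [← Real.log_div pas.ne' pa.ne', ← Real.log_div pbs.ne' pb.ne'] at h1
    exact (Real.log_le_log_iff (div_pos pbs pb) (div_pos pas pa)).1 h1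
  have en : ∀ n : ℕ, 0 ≤ εb * n := fun n => by positivity
  have hrate : ∀ n, rate φ εb n = φ (g (εb * n)) / φ 1 := fun n => by
    rw [rate, hinv _ (en n)]
  have hdel : ∀ n, deltaSeq φ εb n = εb * deriv φ (g (εb * n)) := fun n => by
    rw [deltaSeq, hinv _ (en n)]
  have p1 := hφpos 1 le_rfl
  have esucc : ∀ n : ℕ, εb * ((n + 1 : ℕ) : ℝ) = εb * n + εb := fun n => by push_cast; ring
  have gtop : Tendsto g atTop atTop := by
    refine tendsto_atTop_atTop.2 fun b => ⟨h b, fun a ha => ?_⟩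
    rw [← gh b]
    exact gmono.monotone ha
  refine ⟨⟨?_, ?_, ?_, ?_, ?_, ?_⟩, fun n v => g (h v + εb * n) - g (εb * n),
    fun n v => φ (g (h v + εb * n)) / φ v, ⟨?_, ?_, ?_, ?_, ?_, ?_, ?_, ?_⟩⟩
  · intro n
    rw [hrate, le_div_iff₀ p1, one_mul]
    simpa [g0] using φg 0 _ le_rfl (en n)
  · intro n
    rw [hrate, hrate, hrate, esucc]
    have := ratio εb hε.le self_mem_Ici (show εb * n ∈ Ici (0:ℝ) from en n) (en n)
    simp only [g0, zero_add] at this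
    rw [div_le_iff₀ (hφpos _ (g1 _ (en n)))] at this
    rw [div_mul_div_comm, div_le_div_iff₀ p1 (mul_pos p1 p1)]
    simp only [Nat.cast_one, mul_one]
    calc φ (g (εb * n + εb)) * (φ 1 * φ 1)
        ≤ (φ (g εb) / φ 1 * φ (g (εb * n))) * (φ 1 * φ 1) := by gcongr
      _ = _ := by field_simp
  · intro n
    rw [hrate, hrate, hdel, ← sub_div, ← mul_div_assoc]
    refine div_le_div_of_nonneg_right ?_ p1.le
    have hle : εb * (n:ℝ) ≤ εb * ((n + 1 : ℕ) : ℝ) := by rw [esucc]; linarith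
    have h1 := hφconc.le_tangent hφdiff (g1 _ (en (n + 1))) (g1 _ (en n))
    have h2 := (gslope _ _ (en n) hle).2
    have h3 : εb * ((n + 1 : ℕ) : ℝ) - εb * n = εb := by rw [esucc]; ring
    rw [h3] at h2
    have h4 := mul_le_mul_of_nonneg_left h2 (hdnn _ (g1 _ (en n)))
    linarith
  · intro n
    rw [hdel]
    exact mul_nonneg hε.le (hdnn _ (g1 _ (en n)))
  · intro m n hmn
    rw [hdel, hdel]
    have hle : εb * (m:ℝ) ≤ εb * n := by gcongr
    exact mul_le_mul_of_nonneg_left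
      (hanti (g1 _ (en m)) (g1 _ (en n)) (gmono.monotone hle)) hε.le
  · have : deltaSeq φ εb = fun n : ℕ => εb * deriv φ (g (εb * n)) := funext hdel
    rw [this]
    have h1 : Tendsto (fun n : ℕ => εb * (n : ℝ)) atTop atTop :=
      tendsto_natCast_atTop_atTop.const_mul_atTop hε
    simpa using (hφderiv0.comp (gtop.comp h1)).const_mul εb
  · intro n
    have := gmono.monotone.measurable
    exact (this.comp (hcont.measurable.add_const _)).sub_const _
  · intro v
    simp [gh, g0]
  · intro n
    simp [h0]
  · intro n v hv
    have := gmono.monotone (show εb * (n:ℝ) ≤ h v + εb * n by linarith [hnn v hv])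
    linarith
  · intro n u v hu hv
    refine le_tangent_of_antitoneOn (f := fun v => g (h v + εb * n) - g (εb * n))
      (f' := fun v => φ (g (h v + εb * n)) / φ v) ?_ ?_ ?_ hu hv
    · intro x hx
      have h1 := (gder (h x + εb * n) (add_nonneg (hnn x hx) (en n))).continuousAt
      have h2 : ContinuousAt (fun v => h v + εb * n) x := by fun_prop
      exact ((ContinuousAt.comp (f := fun v => h v + εb * n) h1 h2).sub
        continuousAt_const).continuousWithinAt
    · intro x hx
      have h1 := gder (h x + εb * n) (add_nonneg (hnn x hx.le) (en n))
      exact (HasDerivAt.comp x h1 ((hder x hx).add_const _)).sub_const _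
    · intro a ha b hb hab
      have := ratio (εb * n) (en n) (hnn a ha) (hnn b hb) (hmono hab)
      simpa only [gh] using this
  · intro n v hv
    exact div_nonneg (hφpos _ (g1 _ (add_nonneg (hnn v hv) (en n)))).le (hφpos v hv).le
  · intro n v hv
    rw [hrate]
    have := ratio (εb * n) (en n) self_mem_Ici (hnn v hv) (hnn v hv)
    simpa only [gh, zero_add, g0] using this
  · intro n v hv
    rw [mul_div_cancel₀ _ (hφpos v hv).ne', hrate, esucc]
    have h1 := (gslope (h v + εb * n) (h v + (εb * n + εb)) (add_nonneg (hnn v hv) (en n))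
      (by linarith)).2
    have h2 := (gslope (εb * n) (εb * n + εb) (en n) (by linarith)).1
    have h3 : εb * φ 1 * (φ (g (εb * n)) / φ 1) = εb * φ (g (εb * n)) := by field_simp
    rw [h3]
    ring_nf at h1 h2 ⊢
    linarith

/-- The tails of a series with products of nonincreasing factors solve the backward recursion
of the expected number of renewals. -/
lemma exists_backward_sequence {d : ℕ → ℝ} {q : ℝ} (hq0 : 0 < q) (hq1 : q < 1)
    (hd0 : ∀ n, 0 ≤ d n) (hd : Antitone d) (hlim : Tendsto d atTop (nhds 0)) :
    ∃ c : ℕ → ℝ, c 0 = ∑' j : ℕ, q ^ j * ∏ k ∈ Finset.Icc 1 j, (1 + d k) ∧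
      (∀ n, 0 ≤ c n) ∧ (∀ n, c (n + 1) ≤ c n) ∧
      ∀ n, c n = 1 + q * (1 + d (n + 1)) * c (n + 1) := by
  set a : ℕ → ℕ → ℝ := fun n j => q ^ j * ∏ k ∈ Finset.Icc 1 j, (1 + d (k + n)) with ha
  have hp : ∀ k, 0 < 1 + d k := fun k => by linarith [hd0 k]
  have hapos : ∀ n j, 0 < a n j := fun n j =>
    mul_pos (pow_pos hq0 j) (Finset.prod_pos fun k _ => hp _)
  have hratio : ∀ n j, a n (j + 1) = q * (1 + d (j + 1 + n)) * a n j := by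
    intro n j
    simp only [ha, Finset.prod_Icc_succ_top (Nat.le_add_left 1 j), pow_succ]
    ring
  have hsum : ∀ n, Summable (a n) := by
    intro n
    refine summable_of_ratio_test_tendsto_lt_one hq1
      (Eventually.of_forall fun j => (hapos n j).ne') ?_
    have : (fun j => ‖a n (j + 1)‖ / ‖a n j‖) = fun j => q * (1 + d (j + (1 + n))) := by
      ext j
      rw [Real.norm_of_nonneg (hapos n _).le, Real.norm_of_nonneg (hapos n _).le, hratio,
        mul_div_cancel_right₀ _ (hapos n j).ne', add_assoc j]
    rw [this]
    simpa using ((hlim.comp (tendsto_add_atTop_nat (1 + n))).const_add 1).const_mul q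
  have hshift : ∀ n j, a n (j + 1) = q * (1 + d (n + 1)) * a (n + 1) j := by
    intro n j
    induction j with
    | zero => simp [ha, add_comm]
    | succ j ih =>
      rw [hratio, ih, hratio, show j + 1 + 1 + n = j + 1 + (n + 1) by ring]
      ring
  refine ⟨fun n => ∑' j, a n j, by simp [ha], fun n => tsum_nonneg fun j => (hapos n j).le,
    fun n => ?_, fun n => ?_⟩
  · refine (hsum (n + 1)).tsum_le_tsum (fun j => ?_) (hsum n)
    refine mul_le_mul_of_nonneg_left (Finset.prod_le_prod (fun k _ => (hp _).le) fun k _ => ?_)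
      (pow_pos hq0 j).le
    have := hd (show k + n ≤ k + (n + 1) by omega)
    linarith
  · simp only
    rw [(hsum n).tsum_eq_zero_add, ← tsum_mul_left]
    congr 1
    · simp [ha]
    · exact tsum_congr (hshift n)

/-- A summed Foster–Lyapunov inequality for an inhomogeneous Markov chain. -/
lemma tsum_lintegral_iterKernel_le {S : Type*} [MeasurableSpace S] (K : ℕ → Kernel S S)
    {h Ψ : ℕ → S → ENNReal} (hh : ∀ n, Measurable (h n)) (hΨ : ∀ n, Measurable (Ψ n))
    (hstep : ∀ n s, h n s + ∫⁻ t, Ψ (n + 1) t ∂(K (n + 1) s) ≤ Ψ n s) (s : S) :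
    ∑' n, ∫⁻ t, h n t ∂(iterKernel K n s) ≤ Ψ 0 s := by
  have key : ∀ N, ∑ n ∈ Finset.range N, ∫⁻ t, h n t ∂(iterKernel K n s) +
      ∫⁻ t, Ψ N t ∂(iterKernel K N s) ≤ Ψ 0 s := by
    intro N
    induction N with
    | zero => simp [iterKernel, Kernel.id_apply, lintegral_dirac' _ (hΨ 0)]
    | succ N ih =>
      refine le_trans ?_ ih
      rw [Finset.sum_range_succ, add_assoc]
      gcongr
      rw [iterKernel, Kernel.lintegral_comp _ _ _ (hΨ _), ← lintegral_add_left (hh N)]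
      exact lintegral_mono fun t => hstep N t
  rw [ENNReal.tsum_eq_iSup_nat]
  exact iSup_le fun N => le_self_add.trans (key N)

lemma lintegral_prod_le_of_le_affine {X : Type*} [MeasurableSpace X] {V : X → ℝ}
    {μ μ' : Measure X} [IsProbabilityMeasure μ] [IsProbabilityMeasure μ']
    (hV : ∀ x, 1 ≤ V x) (hμ : Integrable V μ) (hμ' : Integrable V μ') {f : ℝ → ℝ} {a c : ℝ}
    (hf0 : ∀ u, 1 ≤ u → 0 ≤ f u) (hf : ∀ u, 1 ≤ u → f u ≤ a + c * u) :
    ∫⁻ p, ENNReal.ofReal (f (V p.1 + V p.2 - 1)) ∂(μ.prod μ') ≤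
      ENNReal.ofReal (a + c * (∫ y, V y ∂μ + ∫ y, V y ∂μ' - 1)) := by
  have h1 : ∀ p : X × X, 1 ≤ V p.1 + V p.2 - 1 := fun p => by linarith [hV p.1, hV p.2]
  have i1 := hμ.comp_fst μ'
  have i2 := hμ'.comp_snd μ
  have i12 : Integrable (fun p : X × X => V p.1 + V p.2) (μ.prod μ') := i1.add i2
  have i3 : Integrable (fun p : X × X => V p.1 + V p.2 - 1) (μ.prod μ') :=
    i12.sub (integrable_const (1:ℝ))
  have i4 : Integrable (fun p : X × X => a + c * (V p.1 + V p.2 - 1)) (μ.prod μ') :=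
    (integrable_const a).add (i3.const_mul c)
  calc ∫⁻ p, ENNReal.ofReal (f (V p.1 + V p.2 - 1)) ∂(μ.prod μ')
      ≤ ∫⁻ p, ENNReal.ofReal (a + c * (V p.1 + V p.2 - 1)) ∂(μ.prod μ') :=
        lintegral_mono fun p => ENNReal.ofReal_le_ofReal (hf _ (h1 p))
    _ = ENNReal.ofReal (∫ p, (a + c * (V p.1 + V p.2 - 1)) ∂(μ.prod μ')) :=
        (ofReal_integral_eq_lintegral_ofReal i4
          (Eventually.of_forall fun p => (hf0 _ (h1 p)).trans (hf _ (h1 p)))).symm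
    _ = _ := by
        congr 1
        calc ∫ p, (a + c * (V p.1 + V p.2 - 1)) ∂(μ.prod μ')
            = ∫ p : X × X, a ∂(μ.prod μ') + c * (∫ p, V p.1 ∂(μ.prod μ') +
              ∫ p, V p.2 ∂(μ.prod μ') - ∫ p : X × X, (1:ℝ) ∂(μ.prod μ')) := by
              rw [← integral_add i1 i2, ← integral_sub i12 (integrable_const _),
                ← integral_const_mul, ← integral_add (integrable_const _) (i3.const_mul c)]
          _ = _ := by
              rw [integral_fun_fst, integral_fun_snd]
              simp

section Residual

variable {X : Type*} [MeasurableSpace X] {P : ℕ → Kernel X X} {ν : ℕ → Measure X} {εν : ℝ}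
  {k : ℕ} {x : X}

lemma smul_Qmeas_add [IsFiniteMeasure (ν k)] (h1 : εν < 1)
    (hle : ENNReal.ofReal εν • ν k ≤ P k x) :
    ENNReal.ofReal (1 - εν) • Qmeas P ν εν k x + ENNReal.ofReal εν • ν k = P k x := by
  have hne : ENNReal.ofReal (1 - εν) ≠ 0 := by simpa using h1
  have : IsFiniteMeasure (ENNReal.ofReal εν • ν k) := Measure.smul_finite _ ENNReal.ofReal_ne_top
  rw [Qmeas, smul_smul, ENNReal.mul_inv_cancel hne ENNReal.ofReal_ne_top, one_smul,
    Measure.sub_add_cancel_of_le hle]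

lemma isProbabilityMeasure_Qmeas [IsProbabilityMeasure (ν k)] [IsProbabilityMeasure (P k x)]
    (h0 : 0 < εν) (h1 : εν < 1) (hle : ENNReal.ofReal εν • ν k ≤ P k x) :
    IsProbabilityMeasure (Qmeas P ν εν k x) := by
  have h := congrArg (fun m : Measure X => m univ) (smul_Qmeas_add h1 hle)
  have hne : ENNReal.ofReal (1 - εν) ≠ 0 := by simpa using h1
  have e : ENNReal.ofReal (1 - εν) + ENNReal.ofReal εν = 1 := by
    rw [← ENNReal.ofReal_add (by linarith) h0.le]
    simp
  simp only [Measure.add_apply, Measure.smul_apply, smul_eq_mul, measure_univ, mul_one] at h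
  rw [← e] at h
  have h2 := (ENNReal.add_left_inj ENNReal.ofReal_ne_top).1 h
  exact ⟨(ENNReal.mul_right_inj hne ENNReal.ofReal_ne_top).1 (h2.trans (mul_one _).symm)⟩

lemma integral_Qmeas_le [IsProbabilityMeasure (ν k)] [IsProbabilityMeasure (P k x)] {V : X → ℝ}
    (hV : ∀ x, 1 ≤ V x) (hint : Integrable V (P k x))
    (h0 : 0 < εν) (h1 : εν < 1) (hle : ENNReal.ofReal εν • ν k ≤ P k x) :
    Integrable V (Qmeas P ν εν k x) ∧
      (1 - εν) * ∫ y, V y ∂(Qmeas P ν εν k x) + εν ≤ ∫ y, V y ∂(P k x) := by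
  have hne : ENNReal.ofReal (1 - εν) ≠ 0 := by simpa using h1
  have hne' : ENNReal.ofReal εν ≠ 0 := by simpa using h0
  have h := smul_Qmeas_add h1 hle
  rw [← h] at hint ⊢
  have i1 := hint.left_of_add_measure
  have i2 := hint.right_of_add_measure
  have i3 := (integrable_smul_measure hne ENNReal.ofReal_ne_top).1 i1
  have i4 := (integrable_smul_measure hne' ENNReal.ofReal_ne_top).1 i2
  refine ⟨i3, ?_⟩
  rw [integral_add_measure i1 i2, integral_smul_measure, integral_smul_measure,
    ENNReal.toReal_ofReal h0.le, ENNReal.toReal_ofReal (by linarith), smul_eq_mul, smul_eq_mul]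
  have : (1:ℝ) ≤ ∫ y, V y ∂(ν k) := by
    simpa using integral_mono (μ := ν k) (integrable_const 1) i4 hV
  nlinarith

end Residual

lemma exists_mem_of_drift {X : Type*} [MeasurableSpace X] [Nonempty X] {κ : Kernel X X}
    [IsMarkovKernel κ] {V ψ : X → ℝ} {C : Set X} {bV m : ℝ} (hV : ∀ x, 1 ≤ V x)
    (hint : ∀ x, Integrable V (κ x)) (hm : 0 < m) (hψ : ∀ x, m ≤ ψ x)
    (hdrift : ∀ x, ∫ y, V y ∂(κ x) ≤ V x - ψ x + bV * C.indicator 1 x) :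
    0 < bV ∧ C.Nonempty := by
  have hbdd : BddBelow (range V) := ⟨1, by rintro _ ⟨x, rfl⟩; exact hV x⟩
  obtain ⟨x, hx⟩ := exists_lt_of_ciInf_lt (show ⨅ x, V x < (⨅ x, V x) + m by linarith)
  have h1 : ⨅ x, V x ≤ ∫ y, V y ∂(κ x) := by
    simpa using integral_mono (μ := κ x) (integrable_const (⨅ x, V x)) (hint x)
      (fun y => ciInf_le hbdd y)
  have h2 := hdrift x
  have h3 := hψ x
  by_cases hxC : x ∈ C
  · simp only [indicator_of_mem hxC, Pi.one_apply, mul_one] at h2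
    exact ⟨by linarith, x, hxC⟩
  · simp only [indicator_of_notMem hxC, mul_zero, add_zero] at h2
    linarith

/-- The weight of the drift potential in the bound on the rate at the next visit to `C × C`. -/
noncomputable def visitWeight (φ : ℝ → ℝ) (εb : ℝ) (n : ℕ) : ℝ :=
  min (deltaSeq φ εb (n + 1)) 1 * (rate φ εb 1 ^ 2 / (εb * φ 1))

noncomputable def couplingPotential (φ : ℝ → ℝ) (εb B : ℝ) (W : ℕ → ℝ → ℝ) (c : ℕ → ℝ)
    (n : ℕ) (v : ℝ) : ℝ :=
  W n v + B * c n * (rate φ εb (n + 1) + visitWeight φ εb n * W n v)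

section Potential

variable {φ : ℝ → ℝ} {εb : ℝ}

lemma visitWeight_nonneg (hr : IsRate φ εb) (hE : 0 < εb * φ 1) (n : ℕ) :
    0 ≤ visitWeight φ εb n :=
  mul_nonneg (le_min (hr.delta_nonneg _) zero_le_one) (by positivity)

lemma visitWeight_succ_le (hr : IsRate φ εb) (hE : 0 < εb * φ 1) (n : ℕ) :
    visitWeight φ εb (n + 1) ≤ visitWeight φ εb n :=
  mul_le_mul_of_nonneg_right (min_le_min_right _ (hr.delta_anti (Nat.le_succ _))) (by positivity)

lemma visitWeight_le_delta (hr : IsRate φ εb) (hE : 0 < εb * φ 1) (n : ℕ) :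
    visitWeight φ εb (n + 1) ≤ deltaSeq φ εb (n + 1) * (rate φ εb 1 ^ 2 / (εb * φ 1)) :=
  mul_le_mul_of_nonneg_right ((min_le_left _ _).trans (hr.delta_anti (Nat.le_succ _)))
    (by positivity)

lemma rate_sub_le_visitWeight (hr : IsRate φ εb) (hE : 0 < εb * φ 1) (n : ℕ) :
    rate φ εb (n + 2) - rate φ εb (n + 1) ≤
      visitWeight φ εb n * (εb * φ 1 * rate φ εb n) := by
  have e : visitWeight φ εb n * (εb * φ 1 * rate φ εb n) =
      min (deltaSeq φ εb (n + 1)) 1 * (rate φ εb n * rate φ εb 1 * rate φ εb 1) := by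
    rw [visitWeight]
    generalize εb * φ 1 = E at hE ⊢
    field_simp
  have h1 : 1 ≤ rate φ εb 1 := hr.one_le 1
  have h2 : rate φ εb (n + 2) ≤ rate φ εb n * rate φ εb 1 * rate φ εb 1 :=
    (hr.succ_le (n + 1)).trans (mul_le_mul_of_nonneg_right (hr.succ_le n) (by linarith))
  have h3 := hr.one_le (n + 2)
  have h4 := hr.one_le (n + 1)
  rw [e]
  rcases min_choice (deltaSeq φ εb (n + 1)) 1 with h | h
  · rw [h]
    exact (hr.sub_le (n + 1)).trans (mul_le_mul_of_nonneg_left h2 (hr.delta_nonneg _))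
  · rw [h]
    linarith

variable {W D : ℕ → ℝ → ℝ} {c : ℕ → ℝ} {B : ℝ}

lemma couplingPotential_nonneg (hr : IsRate φ εb) (hW : IsRatePotential φ εb W D)
    (hE : 0 < εb * φ 1) (hB : 0 ≤ B) (hc : ∀ n, 0 ≤ c n) (n : ℕ) {v : ℝ} (hv : 1 ≤ v) :
    0 ≤ couplingPotential φ εb B W c n v := by
  have h1 := hW.nonneg n v hv
  have h2 := hr.one_le (n + 1)
  have h3 := visitWeight_nonneg hr hE n
  have h4 := hc n
  rw [couplingPotential]
  positivity

lemma exists_affine_bound_outside (hr : IsRate φ εb) (hW : IsRatePotential φ εb W D)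
    (hE : 0 < εb * φ 1) (hB : 0 ≤ B) (hc : ∀ n, 0 ≤ c n)
    (hc' : ∀ n, c (n + 1) ≤ c n) (n : ℕ) {v m : ℝ} (hv : 1 ≤ v) (hm : m ≤ v - εb * φ v) :
    ∃ a s : ℝ, (∀ u, 1 ≤ u → couplingPotential φ εb B W c (n + 1) u ≤ a + s * u) ∧
      εb * φ 1 * rate φ εb n + (a + s * m) ≤ couplingPotential φ εb B W c n v := by
  set κ := visitWeight φ εb n
  have hκ : 0 ≤ κ := visitWeight_nonneg hr hE n
  have hκ' := visitWeight_succ_le hr hE n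
  have hcn := hc (n + 1)
  have hD := hW.deriv_nonneg (n + 1) v hv
  set w := W (n + 1) v
  set D' := D (n + 1) v
  set b := B * c (n + 1)
  have hb : 0 ≤ b := mul_nonneg hB hcn
  have hl : 0 ≤ 1 + b * κ := by positivity
  refine ⟨(w - D' * v) * (1 + b * κ) + b * rate φ εb (n + 2), D' * (1 + b * κ), ?_, ?_⟩
  · intro u hu
    have h1 := hW.tangent (n + 1) u v hu hv
    have h2 := hW.nonneg (n + 1) u hu
    calc couplingPotential φ εb B W c (n + 1) u
        ≤ W (n + 1) u + b * (rate φ εb (n + 2) + κ * W (n + 1) u) := by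
          rw [couplingPotential]
          gcongr
      _ = W (n + 1) u * (1 + b * κ) + b * rate φ εb (n + 2) := by ring
      _ ≤ (w + D' * (u - v)) * (1 + b * κ) + b * rate φ εb (n + 2) := by gcongr
      _ = _ := by ring
  · have h1 : w + D' * (m - v) ≤ W n v - εb * φ 1 * rate φ εb n := by
      have := mul_le_mul_of_nonneg_left hm hD
      have := hW.step n v hv
      simp only [w, D'] at *
      linarith
    have h2 := rate_sub_le_visitWeight hr hE n
    have h3 := mul_le_mul_of_nonneg_right h1 hl
    have h4 := mul_le_mul_of_nonneg_left h2 hb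
    have h5 : b ≤ B * c n := mul_le_mul_of_nonneg_left (hc' n) hB
    have h6 : 0 ≤ rate φ εb (n + 1) + κ * W n v := by
      have := hW.nonneg n v hv
      have := hr.one_le (n + 1)
      positivity
    have h7 := mul_le_mul_of_nonneg_right h5 h6
    rw [couplingPotential]
    simp only [κ] at *
    linarith

lemma exists_affine_bound_inside {εν bV L : ℝ} (hr : IsRate φ εb) (hW : IsRatePotential φ εb W D)
    (hE : 0 < εb * φ 1) (hεb : εb ≤ 1) (hε0 : 0 ≤ εν) (hε1 : εν ≤ 1) (hbV : 0 ≤ bV)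
    (hB : 2 * bV ≤ B) (hc : ∀ n, 0 ≤ c n)
    (hrec : ∀ n, c n = 1 + (1 - εν) * (1 + deltaSeq φ εb (n + 1) *
      (rate φ εb 1 * (1 + 2 * rate φ εb 1 / (εb * φ 1) * (L - 1)))) * c (n + 1))
    (n : ℕ) {v m : ℝ} (hv : 1 ≤ v) (hφv : 0 ≤ φ v)
    (hm : (1 - εν) * m + εν ≤ v - φ v + 2 * bV) (hmL : m - 1 ≤ 2 * (L - 1)) (hm1 : 1 ≤ m) :
    ∃ a s : ℝ, (∀ u, 1 ≤ u → couplingPotential φ εb B W c (n + 1) u ≤ a + s * u) ∧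
      εb * φ 1 * rate φ εb n + (1 - εν) * (a + s * m) ≤ couplingPotential φ εb B W c n v := by
  have hκ0 := visitWeight_nonneg hr hE (n + 1)
  have hκ := visitWeight_le_delta hr hE n
  set κ := visitWeight φ εb (n + 1)
  have hB0 : 0 ≤ B := by linarith
  have hq : 0 ≤ 1 - εν := by linarith
  have hD := hW.deriv_nonneg (n + 1) v hv
  have hD1 := hW.deriv_le (n + 1) v hv
  have hstep := hW.step n v hv
  have htan := hW.tangent (n + 1) 1 v le_rfl hv
  rw [hW.one] at htan
  set w := W (n + 1) v
  set D' := D (n + 1) v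
  set b := B * c (n + 1)
  have hb : 0 ≤ b := mul_nonneg hB0 (hc _)
  set r := rate φ εb (n + 1) with hrdef
  have hr1 : 1 ≤ r := hr.one_le (n + 1)
  refine ⟨w - D' * v + b * (rate φ εb (n + 2) - κ * r), D' + b * (κ * r), ?_, ?_⟩
  · intro u hu
    have h1 := hW.tangent (n + 1) u v hu hv
    have h2 := hW.le_rate_mul (n + 1) hu
    calc couplingPotential φ εb B W c (n + 1) u
        ≤ (w + D' * (u - v)) + b * (rate φ εb (n + 2) + κ * (r * (u - 1))) := by
          rw [couplingPotential]
          gcongr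
      _ = _ := by ring
  · have h1 : (1 - εν) * (w + D' * (m - v)) ≤ W n v - εb * φ 1 * rate φ εb n + 2 * bV * r := by
      have e1 := mul_le_mul_of_nonneg_left hm hD
      have e2 := mul_nonneg hε0 htan
      have e3 := mul_le_mul_of_nonneg_left hD1 hbV
      have e4 := mul_le_mul_of_nonneg_right hεb (mul_nonneg hφv hD)
      linarith
    have hδ := hr.delta_nonneg (n + 1)
    set δ := deltaSeq φ εb (n + 1)
    have h2 : rate φ εb (n + 2) + κ * r * (m - 1) ≤
        r * (1 + δ * (rate φ εb 1 * (1 + 2 * rate φ εb 1 / (εb * φ 1) * (L - 1)))) := by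
      have e1 : rate φ εb (n + 2) - r ≤ δ * rate φ εb (n + 2) := hr.sub_le (n + 1)
      have e2 : rate φ εb (n + 2) ≤ r * rate φ εb 1 := hr.succ_le (n + 1)
      have e3 := mul_le_mul_of_nonneg_left e2 hδ
      have e4 : κ * (r * (m - 1)) ≤ δ * (rate φ εb 1 ^ 2 / (εb * φ 1)) * (r * (2 * (L - 1))) := by
        have : 0 ≤ m - 1 := by linarith
        gcongr
      have e5 : r * (1 + δ * (rate φ εb 1 * (1 + 2 * rate φ εb 1 / (εb * φ 1) * (L - 1)))) =
          r + δ * (r * rate φ εb 1) +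
            δ * (rate φ εb 1 ^ 2 / (εb * φ 1)) * (r * (2 * (L - 1))) := by
        ring
      rw [e5]
      linarith
    have h3 := mul_le_mul_of_nonneg_left h2 (mul_nonneg hq hb)
    have h4 : B * c n = B + (1 - εν) * (1 + δ * (rate φ εb 1 *
        (1 + 2 * rate φ εb 1 / (εb * φ 1) * (L - 1)))) * b := by
      rw [hrec n]
      ring
    have h5 : 0 ≤ B * c n * (visitWeight φ εb n * W n v) :=
      mul_nonneg (mul_nonneg hB0 (hc n)) (mul_nonneg (visitWeight_nonneg hr hE n)
        (hW.nonneg n v hv))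
    have h6 := mul_le_mul_of_nonneg_right hB (zero_le_one.trans hr1)
    have h7 := congrArg (· * r) h4
    rw [couplingPotential, mul_add, ← hrdef]
    linarith

end Potential

lemma measurable_ite_flag {Y : Type*} [MeasurableSpace Y] {f : Y → ENNReal} (hf : Measurable f) :
    Measurable fun t : Y × Bool => if t.2 = false then f t.1 else 0 :=
  Measurable.ite (measurable_snd (measurableSet_singleton false)) (hf.comp measurable_fst)
    measurable_const

lemma lintegral_map_flag {Y : Type*} [MeasurableSpace Y] (μ : Measure Y)
    {f : Y → ENNReal} (hf : Measurable f) :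
    ∫⁻ t, (if t.2 = false then f t.1 else 0) ∂(μ.map fun y => (y, false)) = ∫⁻ y, f y ∂μ := by
  rw [lintegral_map (measurable_ite_flag hf) (by fun_prop)]
  simp

/-- Lemma 5.7.  Since the coupling flag is absorbing, `{τ > n} = {D_n = false}`, so
`E[∑_{n<τ} r(n)] = ∑_n r(n) P(D_n = false)`, expressed via the n-step marginals. -/
theorem statement16 {X : Type*} [MeasurableSpace X]
    (P : ℕ → Kernel X X) (hP : ∀ k, IsMarkovKernel (P k))
    (C : Set X) (hC : MeasurableSet C)
    (V : X → ℝ) (hVmeas : Measurable V) (hV1 : ∀ x, 1 ≤ V x)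
    (φ : ℝ → ℝ)
    (hφconc : ConcaveOn ℝ (Set.Ici 1) φ)
    (hφmono : MonotoneOn φ (Set.Ici 1))
    (hφdiff : ∀ t, 1 ≤ t → DifferentiableAt ℝ φ t)
    (hφpos : ∀ t, 1 ≤ t → 0 < φ t)
    (hφderiv0 : Tendsto (deriv φ) atTop (nhds 0))
    (ν : ℕ → Measure X) (hν : ∀ k, IsProbabilityMeasure (ν k))
    (εν εb : ℝ) (hεν : εν ∈ Set.Ioo (0:ℝ) 1) (hεb : εb ∈ Set.Ioo (0:ℝ) 1)
    (bV cV : ℝ)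
    (hVint : ∀ k, 1 ≤ k → ∀ x, Integrable V (P k x))
    (hdrift : ∀ k, 1 ≤ k → ∀ x,
      ∫ y, V y ∂(P k x) ≤ V x - φ (V x) + bV * C.indicator 1 x)
    (hminor : ∀ k, 1 ≤ k → ∀ x ∈ C, ∀ A : Set X, MeasurableSet A →
      ENNReal.ofReal εν * ν k A ≤ P k x A)
    (hout : ∀ x ∉ C, bV / (1 - εb) ≤ φ (V x))
    (hin : ∀ x ∈ C, V x ≤ cV)
    -- the coupling construction (Definition 5.1); the flag `true` indicates coupling:
    (Pbar : ℕ → Kernel ((X × X) × Bool) ((X × X) × Bool))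
    (hPbar : ∀ k, IsMarkovKernel (Pbar k))
    (hbar_in : ∀ k, 1 ≤ k → ∀ x x' : X, x ∈ C → x' ∈ C →
      Pbar k ((x, x'), false) =
        ENNReal.ofReal εν • ((ν k).map fun y => ((y, y), true)) +
        ENNReal.ofReal (1 - εν) •
          (((Qmeas P ν εν k x).prod (Qmeas P ν εν k x')).map fun p => (p, false)))
    (hbar_out : ∀ k, 1 ≤ k → ∀ x x' : X, ¬(x ∈ C ∧ x' ∈ C) →
      Pbar k ((x, x'), false) =
        (((P k x).prod (P k x')).map fun p => (p, false)))
    (hbar_diag : ∀ k, 1 ≤ k → ∀ x : X,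
      Pbar k ((x, x), true) = (P k x).map fun y => ((y, y), true))
    (hbar_ne : ∀ k, 1 ≤ k → ∀ x x' : X, x ≠ x' →
      Pbar k ((x, x'), true) = Measure.dirac ((x, x'), true)) :
    ∀ x x' : X,
      ∑' n : ℕ, ENNReal.ofReal (rate φ εb n) *
          iterKernel Pbar n ((x, x'), false) {s : (X × X) × Bool | s.2 = false} ≤
        ENNReal.ofReal ((1 / (εb * φ 1)) *
          ((1 + cstar φ εb εν bV cV * bbar φ εb bV * rate φ εb 1 ^ 2 / (εb * φ 1)) *
              (V x + V x' - 1) +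
            (cstar φ εb εν bV cV * bbar φ εb bV * rate φ εb 1 - 1 -
              cstar φ εb εν bV cV * bbar φ εb bV * rate φ εb 1 ^ 2 / (εb * φ 1)))) := by
  intro x x'
  obtain ⟨hε0, hε1⟩ := hεν
  obtain ⟨hb0, hb1⟩ := hεb
  have hφ1 : ∀ t, 1 ≤ t → φ 1 ≤ φ t := fun t ht => hφmono self_mem_Ici ht ht
  have p1 := hφpos 1 le_rfl
  have hE : 0 < εb * φ 1 := mul_pos hb0 p1
  have : Nonempty X := ⟨x⟩
  obtain ⟨hbV, y₀, hy₀⟩ := exists_mem_of_drift (κ := P 1) hV1 (hVint 1 le_rfl) p1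
    (fun y => hφ1 _ (hV1 y)) (hdrift 1 le_rfl)
  have hcV : 1 ≤ cV := (hV1 y₀).trans (hin y₀ hy₀)
  obtain ⟨hr, W, D, hW⟩ := exists_ratePotential hφconc hφmono hφdiff hφpos hφderiv0 hb0
  set L := (bV + cV) / (1 - εν) with hL
  have hL1 : 1 ≤ L := by rw [hL, le_div_iff₀ (by linarith)]; linarith
  set M := Mone φ εb εν bV cV with hM
  have hM0 : 0 ≤ M := by
    have h1 := hr.one_le 1
    have h2 : 0 ≤ L - 1 := by linarith
    rw [hM, Mone]
    positivity
  obtain ⟨c, hc0, hcn, hcs, hrec⟩ := exists_backward_sequence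
    (d := fun k => deltaSeq φ εb k * M) (q := 1 - εν) (by linarith) (by linarith)
    (fun n => mul_nonneg (hr.delta_nonneg n) hM0)
    (fun m n hmn => mul_le_mul_of_nonneg_right (hr.delta_anti hmn) hM0)
    (by simpa using hr.delta_tendsto.mul_const M)
  set B := bbar φ εb bV with hB
  have hB2 : 2 * bV ≤ B := by rw [hB, bbar]; linarith
  have hB0 : 0 ≤ B := by linarith
  set F : ℕ → ℝ → ℝ := fun n v => (εb * φ 1)⁻¹ * couplingPotential φ εb B W c n v with hF
  have hFm : ∀ n, Measurable (F n) := by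
    intro n
    have := hW.measurable n
    simp only [hF, couplingPotential]
    fun_prop
  have hF0 : ∀ n u, 1 ≤ u → 0 ≤ F n u := fun n u hu =>
    mul_nonneg (inv_pos.2 hE).le (couplingPotential_nonneg hr hW hE hB0 hcn n hu)
  set G : ℕ → X × X → ENNReal := fun n p => ENNReal.ofReal (F n (V p.1 + V p.2 - 1)) with hG
  have hGm : ∀ n, Measurable (G n) := by
    intro n
    have := hFm n
    simp only [hG]
    fun_prop
  have haffine : ∀ {n : ℕ} {v m q : ℝ}, (∃ a s : ℝ,
      (∀ u, 1 ≤ u → couplingPotential φ εb B W c (n + 1) u ≤ a + s * u) ∧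
      εb * φ 1 * rate φ εb n + q * (a + s * m) ≤ couplingPotential φ εb B W c n v) →
      ∃ a s : ℝ, (∀ u, 1 ≤ u → F (n + 1) u ≤ a + s * u) ∧
        rate φ εb n + q * (a + s * m) ≤ F n v := by
    rintro n v m q ⟨a, s, h1, h2⟩
    refine ⟨(εb * φ 1)⁻¹ * a, (εb * φ 1)⁻¹ * s, fun u hu => ?_, ?_⟩
    · have := mul_le_mul_of_nonneg_left (h1 u hu) (inv_pos.2 hE).le
      simp only [hF]
      linarith
    · have := mul_le_mul_of_nonneg_left h2 (inv_pos.2 hE).le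
      rw [mul_add, inv_mul_cancel_left₀ hE.ne'] at this
      simp only [hF]
      linarith
  have hstep : ∀ (n : ℕ) (s : (X × X) × Bool),
      (if s.2 = false then ENNReal.ofReal (rate φ εb n) else 0) +
        ∫⁻ t, (if t.2 = false then G (n + 1) t.1 else 0) ∂(Pbar (n + 1) s) ≤
      if s.2 = false then G n s.1 else 0 := by
    rintro n ⟨⟨y, y'⟩, b⟩
    have hk : 1 ≤ n + 1 := Nat.le_add_left 1 n
    cases b with
    | true =>
      simp only [Bool.true_eq_false, if_false, zero_add, nonpos_iff_eq_zero]
      by_cases hyy : y = y'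
      · subst hyy
        rw [hbar_diag _ hk, lintegral_map (measurable_ite_flag (hGm _)) (by fun_prop)]
        simp
      · rw [hbar_ne _ hk y y' hyy, lintegral_dirac' _ (measurable_ite_flag (hGm _))]
        simp
    | false =>
      have hv : 1 ≤ V y + V y' - 1 := by linarith [hV1 y, hV1 y']
      have hφy := hφpos _ (hV1 y)
      have hφy' := hφpos _ (hV1 y')
      have hsub := hφconc.add_le_add_of_Ici_one (hV1 y) (hV1 y')
      have hdy := hdrift _ hk y
      have hdy' := hdrift _ hk y'
      have hrn : 0 ≤ rate φ εb n := zero_le_one.trans (hr.one_le n)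
      simp only [if_true]
      by_cases hCC : y ∈ C ∧ y' ∈ C
      · obtain ⟨hy, hy'⟩ := hCC
        have hle : ∀ z ∈ C, ENNReal.ofReal εν • ν (n + 1) ≤ P (n + 1) z := fun z hz =>
          Measure.le_iff.2 fun A hA => by simpa using hminor _ hk z hz A hA
        have := isProbabilityMeasure_Qmeas hε0 hε1 (hle y hy)
        have := isProbabilityMeasure_Qmeas hε0 hε1 (hle y' hy')
        obtain ⟨i1, q1⟩ := integral_Qmeas_le hV1 (hVint _ hk y) hε0 hε1 (hle y hy)
        obtain ⟨i2, q2⟩ := integral_Qmeas_le hV1 (hVint _ hk y') hε0 hε1 (hle y' hy')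
        have m1 : 1 ≤ ∫ z, V z ∂(Qmeas P ν εν (n + 1) y) := by
          simpa using integral_mono (integrable_const 1) i1 hV1
        have m2 : 1 ≤ ∫ z, V z ∂(Qmeas P ν εν (n + 1) y') := by
          simpa using integral_mono (integrable_const 1) i2 hV1
        simp only [indicator_of_mem hy, indicator_of_mem hy', Pi.one_apply, mul_one] at hdy hdy'
        have hcy := hin y hy
        have hcy' := hin y' hy'
        have l1 : ∫ z, V z ∂(Qmeas P ν εν (n + 1) y) ≤ L := by
          rw [hL, le_div_iff₀ (by linarith)]
          linarith
        have l2 : ∫ z, V z ∂(Qmeas P ν εν (n + 1) y') ≤ L := by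
          rw [hL, le_div_iff₀ (by linarith)]
          linarith
        obtain ⟨a, s, ha, hs⟩ := haffine (exists_affine_bound_inside
          (m := ∫ z, V z ∂(Qmeas P ν εν (n + 1) y) + ∫ z, V z ∂(Qmeas P ν εν (n + 1) y') - 1)
          hr hW hE hb1.le hε0.le hε1.le hbV.le hB2 hcn hrec n hv (hφpos _ hv).le
          (by linarith) (by linarith) (by linarith))
        rw [hbar_in _ hk y y' hy hy', lintegral_add_measure, lintegral_smul_measure,
          lintegral_smul_measure, lintegral_map (measurable_ite_flag (hGm _)) (by fun_prop),
          lintegral_map_flag _ (hGm _)]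
        simp only [Bool.true_eq_false, if_false, lintegral_zero, smul_eq_mul, mul_zero,
          zero_add]
        have hint := lintegral_prod_le_of_le_affine hV1 i1 i2 (hF0 (n + 1)) ha
        have hnn := (hF0 (n + 1) _ (show 1 ≤ ∫ z, V z ∂(Qmeas P ν εν (n + 1) y) +
          ∫ z, V z ∂(Qmeas P ν εν (n + 1) y') - 1 by linarith)).trans (ha _ (by linarith))
        refine (add_le_add_right (mul_le_mul_right hint _) _).trans ?_
        rw [← ENNReal.ofReal_mul (by linarith),
          ← ENNReal.ofReal_add hrn (mul_nonneg (by linarith) hnn)]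
        exact ENNReal.ofReal_le_ofReal hs
      · have m1 : 1 ≤ ∫ z, V z ∂(P (n + 1) y) := by
          simpa using integral_mono (integrable_const 1) (hVint _ hk y) hV1
        have m2 : 1 ≤ ∫ z, V z ∂(P (n + 1) y') := by
          simpa using integral_mono (integrable_const 1) (hVint _ hk y') hV1
        have hout' : ∀ z ∉ C, bV ≤ φ (V z) - εb * φ (V z) := fun z hz => by
          have := (div_le_iff₀ (by linarith)).1 (hout z hz)
          linarith
        have hmul := mul_le_mul_of_nonneg_left hsub hb0.le
        have hy1 := mul_le_mul_of_nonneg_right hb1.le hφy.le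
        have hy1' := mul_le_mul_of_nonneg_right hb1.le hφy'.le
        have hm : ∫ z, V z ∂(P (n + 1) y) + ∫ z, V z ∂(P (n + 1) y') - 1 ≤
            V y + V y' - 1 - εb * φ (V y + V y' - 1) := by
          by_cases hy : y ∈ C
          · have hy' : y' ∉ C := fun h => hCC ⟨hy, h⟩
            have := hout' y' hy'
            simp only [indicator_of_mem hy, indicator_of_notMem hy', Pi.one_apply, mul_one,
              mul_zero] at hdy hdy'
            linarith
          · have := hout' y hy
            have hle : bV * C.indicator 1 y' ≤ bV := by
              by_cases hy' : y' ∈ C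
              · simp [hy']
              · simp [hy', hbV.le]
            simp only [indicator_of_notMem hy, mul_zero] at hdy
            linarith
        obtain ⟨a, s, ha, hs⟩ := haffine (q := 1) (by
          simpa only [one_mul] using
            exists_affine_bound_outside hr hW hE hB0 hcn hcs n hv hm)
        rw [one_mul] at hs
        rw [hbar_out _ hk y y' hCC, lintegral_map_flag _ (hGm _)]
        have hint := lintegral_prod_le_of_le_affine hV1 (hVint _ hk y) (hVint _ hk y')
          (hF0 (n + 1)) ha
        have hnn := (hF0 (n + 1) _ (show 1 ≤ ∫ z, V z ∂(P (n + 1) y) +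
          ∫ z, V z ∂(P (n + 1) y') - 1 by linarith)).trans (ha _ (by linarith))
        refine (add_le_add_right hint _).trans ?_
        rw [← ENNReal.ofReal_add hrn hnn]
        exact ENNReal.ofReal_le_ofReal hs
  have hmain := tsum_lintegral_iterKernel_le Pbar
    (fun n => measurable_ite_flag (measurable_const (a := ENNReal.ofReal (rate φ εb n))))
    (fun n => measurable_ite_flag (hGm n)) hstep ((x, x'), false)
  have hset : MeasurableSet {s : (X × X) × Bool | s.2 = false} :=
    measurable_snd (measurableSet_singleton false)
  calc _ = ∑' n, ∫⁻ t, (if t.2 = false then ENNReal.ofReal (rate φ εb n) else 0)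
        ∂(iterKernel Pbar n ((x, x'), false)) := by
        refine tsum_congr fun n => ?_
        rw [← lintegral_indicator_const hset]
        simp only [indicator_apply, mem_ofPred_eq]
    _ ≤ _ := hmain
    _ ≤ _ := by
        simp only [if_true]
        refine ENNReal.ofReal_le_ofReal ?_
        have hcs0 : c 0 = cstar φ εb εν bV cV := hc0
        have hw : visitWeight φ εb 0 ≤ rate φ εb 1 ^ 2 / (εb * φ 1) :=
          (mul_le_mul_of_nonneg_right (min_le_right _ _) (by positivity)).trans_eq (one_mul _)
        have hv : 0 ≤ V x + V x' - 1 - 1 := by linarith [hV1 x, hV1 x']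
        have hBc : 0 ≤ B * c 0 := mul_nonneg hB0 (hcn 0)
        simp only [hF, couplingPotential, hW.zero]
        rw [one_div]
        refine mul_le_mul_of_nonneg_left ?_ (inv_pos.2 hE).le
        have h1 := mul_le_mul_of_nonneg_left (mul_le_mul_of_nonneg_right hw hv) hBc
        rw [← hcs0]
        have h2 : c 0 * B * rate φ εb 1 ^ 2 / (εb * φ 1) =
          B * c 0 * (rate φ εb 1 ^ 2 / (εb * φ 1)) := by ring
        rw [h2, zero_add]
        linarith
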